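/- arXiv:1501.06086 — 2 statements merged into one kernel-verified Lean document; each statement's English description precedes it below -/
import Mathlib

section
/- For all natural numbers n and k, the number of non-overlapping set partitions of [n] = {1,…,n} containing exactly k multiplets (blocks with at least two elements) equals the coefficient of u^{k+1} in the polynomial F_{n+1} ∈ Polynomial ℚ, where F_1 = u and F_{m+1} = u·F_m' + Σ_{s=1}^{m−1} F_s·F_{m−s}. -/
open Finset Polynomial

attribute [local instance] Classical.propDecidable

/-- Two finsets `α`, `β` of `Fin n` overlap if `min α < min β < max α < max β`. -/
def Overlap {n : ℕ} (α β : Finset (Fin n)) : Prop :=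
  ∃ (hα : α.Nonempty) (hβ : β.Nonempty),
    α.min' hα < β.min' hβ ∧ β.min' hβ < α.max' hα ∧ α.max' hα < β.max' hβ

/-- A set partition is non-overlapping (a NOP) if no two of its blocks overlap. -/
def IsNOP {n : ℕ} (π : Finpartition (univ : Finset (Fin n))) : Prop :=
  ∀ α ∈ π.parts, ∀ β ∈ π.parts, ¬ Overlap α β

def Ov {n : ℕ} (B C : Finset (Fin n)) : Prop :=
  (∃ x ∈ B, ∀ y ∈ C, x < y) ∧ (∃ x ∈ B, ∃ y ∈ C, y < x) ∧ (∃ y ∈ C, ∀ x ∈ B, x < y)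

theorem overlap_iff {n : ℕ} (B C : Finset (Fin n)) : Overlap B C ↔ Ov B C := by
  constructor
  · rintro ⟨hB, hC, h1, h2, h3⟩
    refine ⟨⟨_, B.min'_mem hB, fun y hy => lt_of_lt_of_le h1 (C.min'_le y hy)⟩,
      ⟨_, B.max'_mem hB, _, C.min'_mem hC, h2⟩,
      ⟨_, C.max'_mem hC, fun x hx => lt_of_le_of_lt (B.le_max' x hx) h3⟩⟩
  · rintro ⟨⟨x, hx, h1⟩, ⟨x2, hx2, y2, hy2, h2⟩, ⟨y, hy, h3⟩⟩
    refine ⟨⟨x, hx⟩, ⟨y, hy⟩, ?_, ?_, ?_⟩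
    · exact lt_of_le_of_lt (B.min'_le x hx) (h1 _ (C.min'_mem _))
    · exact lt_of_le_of_lt (C.min'_le _ hy2) (lt_of_lt_of_le h2 (B.le_max' _ hx2))
    · exact lt_of_lt_of_le (h3 _ (B.max'_mem _)) (C.le_max' _ hy)

/-- number of multiplets -/
noncomputable def mult {n : ℕ} (π : Finset (Finset (Fin n))) : ℕ :=
  (π.filter (fun β : Finset (Fin n) => 2 ≤ β.card)).card

/-- non-overlapping partitions of `t ∪ s` in which the elements of `t` lie in
distinct multiplets. -/
structure Good {n : ℕ} (t s : Finset (Fin n)) (π : Finset (Finset (Fin n))) : Prop where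
  ne : ∀ B ∈ π, ∃ x, x ∈ B
  dj : ∀ B ∈ π, ∀ C ∈ π, ∀ x, x ∈ B → x ∈ C → B = C
  cov : ∀ x, x ∈ t ∨ x ∈ s → ∃ B ∈ π, x ∈ B
  sub : ∀ B ∈ π, ∀ x ∈ B, x ∈ t ∨ x ∈ s
  nop : ∀ B ∈ π, ∀ C ∈ π, ¬ Ov B C
  dis : ∀ B ∈ π, ∀ x ∈ B, ∀ y ∈ B, x ∈ t → y ∈ t → x = y
  mul : ∀ B ∈ π, ∀ x ∈ B, x ∈ t → ∃ y ∈ B, y ≠ x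

noncomputable def W {n : ℕ} (t s : Finset (Fin n)) : Polynomial ℚ :=
  ∑ π ∈ univ.filter (Good t s), X ^ mult π

noncomputable def PP : ℕ → ℕ → Polynomial ℚ
  | 0, 0 => 1
  | 0, _ + 1 => 0
  | n + 1, 0 => PP n 0 + X * PP n 1
  | n + 1, h + 1 => ((h : Polynomial ℚ) + 2) * PP n (h + 1) + X * PP n (h + 2) + PP n h

noncomputable def convC (n h : ℕ) : Polynomial ℚ := ∑ a ∈ range n, PP a h * PP (n - 1 - a) 0

theorem convC_succ (n h : ℕ) : convC (n + 1) h =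
    PP 0 h * PP n 0 + ∑ a ∈ range n, PP (a + 1) h * PP (n - 1 - a) 0 := by
  unfold convC
  rw [sum_range_succ', add_comm]
  congr 1
  apply sum_congr rfl
  intro a _
  congr 2
  omega

theorem PP_key (n : ℕ) : ∀ h, PP n (h + 1) = derivative (PP n h) + convC n h := by
  induction n with
  | zero => intro h; cases h <;> simp [PP, convC]
  | succ n ih =>
    intro h
    rw [convC_succ]
    cases h with
    | zero =>
      have e : ∑ a ∈ range n, PP (a + 1) 0 * PP (n - 1 - a) 0 = convC n 0 + X * convC n 1 := by
        simp only [convC, PP, mul_sum, ← sum_add_distrib]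
        exact sum_congr rfl fun _ _ => by ring
      rw [e]
      have h0 := ih 0
      have h1 := ih 1
      simp only [PP, derivative_add, derivative_mul, derivative_X, zero_add] at *
      push_cast
      linear_combination (h0) + X * h1
    | succ h =>
      have e : ∑ a ∈ range n, PP (a + 1) (h + 1) * PP (n - 1 - a) 0 =
          ((h : Polynomial ℚ) + 2) * convC n (h + 1) + X * convC n (h + 2) + convC n h := by
        simp only [convC, PP, mul_sum, ← sum_add_distrib]
        exact sum_congr rfl fun _ _ => by ring
      rw [e]
      have h0 := ih h
      have h1 := ih (h + 1)
      have h2 := ih (h + 2)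
      simp only [PP, derivative_add, derivative_mul, derivative_X, derivative_natCast,
        derivative_ofNat] at *
      push_cast
      linear_combination h0 + ((h : Polynomial ℚ) + 2) * h1 + X * h2

theorem F_eq (F : ℕ → Polynomial ℚ)
    (hF1 : F 1 = X)
    (hF : ∀ m, 1 ≤ m →
      F (m + 1) = X * derivative (F m) + ∑ s ∈ Icc 1 (m - 1), F s * F (m - s))
    (n : ℕ) : F (n + 1) = X * PP n 0 := by
  induction n using Nat.strong_induction_on with
  | _ n ih =>
    cases n with
    | zero => simp [hF1, PP]
    | succ n =>
      rw [hF (n + 1) (by omega), ih n (by omega)]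
      have : ∑ s ∈ Icc 1 (n + 1 - 1), F s * F (n + 1 - s) = X * X * convC n 0 := by
        have : Icc 1 (n + 1 - 1) = (range n).image (· + 1) := by
          ext x; simp only [mem_Icc, mem_image, mem_range]
          constructor
          · intro h; exact ⟨x - 1, by omega, by omega⟩
          · rintro ⟨y, h, rfl⟩; omega
        rw [this, sum_image (by intro a _ b _ h; simpa using h), convC, mul_sum]
        apply sum_congr rfl
        intro a ha
        rw [mem_range] at ha
        rw [ih a (by omega), show n + 1 - (a + 1) = (n - 1 - a) + 1 by omega, ih _ (by omega)]
        ring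
      rw [this]
      have h0 := PP_key n 0
      simp only [PP, derivative_mul, derivative_X, zero_add] at *
      linear_combination -X * X * h0

theorem sing_good {n : ℕ} {t s : Finset (Fin n)} {a : Fin n} (hta : ∀ i ∈ t, i < a)
    (has : ∀ x ∈ s, a < x) (π : Finset (Finset (Fin n))) (h : Good t s π) :
    Good t (insert a s) (insert {a} π) := by
  have ha : ∀ B ∈ π, a ∉ B := fun B hB h' => by
    rcases h.sub B hB a h' with h1 | h1
    · exact lt_irrefl _ (hta _ h1)
    · exact lt_irrefl _ (has _ h1)
  obtain ⟨h1, h2, h3, h4, h5, h6, h7⟩ := h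
  constructor
  · grind
  · grind
  · grind
  · grind
  · intro B hB C hC
    rw [mem_insert] at hB hC
    rcases hB with rfl | hB <;> rcases hC with rfl | hC
    · simp [Ov]
    · simp only [Ov]; grind
    · simp only [Ov]; grind
    · exact h5 B hB C hC
  · grind
  · grind

theorem sing_good' {n : ℕ} {t s : Finset (Fin n)} {a : Fin n} (hta : ∀ i ∈ t, i < a)
    (has : ∀ x ∈ s, a < x) (π : Finset (Finset (Fin n))) (h : Good t (insert a s) π)
    (hp : {a} ∈ π) :
    Good t s (π.erase {a}) := by
  obtain ⟨h1, h2, h3, h4, h5, h6, h7⟩ := h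
  have ha : ∀ B ∈ π, a ∈ B → B = {a} := by grind
  constructor
  · grind
  · grind
  · intro x hx
    obtain ⟨B, hB, hxB⟩ := h3 x (by grind)
    exact ⟨B, by grind, hxB⟩
  · intro B hB x hx
    have := h4 B (by grind) x hx
    grind
  · grind
  · grind
  · grind

theorem sing_sum {n : ℕ} {t s : Finset (Fin n)} {a : Fin n} (hta : ∀ i ∈ t, i < a)
    (has : ∀ x ∈ s, a < x) :
    ∑ π ∈ univ.filter (fun π => Good t (insert a s) π ∧ {a} ∈ π),
      (X : Polynomial ℚ) ^ mult π = W t s := by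
  unfold W
  have hn : ∀ π, Good t s π → ({a} : Finset (Fin n)) ∉ π := by
    intro π h h'
    have := h.sub _ h' a (by simp)
    grind
  refine sum_bij' (fun π _ => π.erase {a}) (fun π _ => insert {a} π) ?_ ?_ ?_ ?_ ?_
  · intro π h
    simp only [mem_filter, mem_univ, true_and] at *
    exact sing_good' hta has π h.1 h.2
  · intro π h
    simp only [mem_filter, mem_univ, true_and] at *
    exact ⟨sing_good hta has π h, by simp⟩
  · intro π h
    simp only [mem_filter, mem_univ, true_and] at *
    exact insert_erase h.2
  · intro π h
    simp only [mem_filter, mem_univ, true_and] at *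
    exact erase_insert (hn π h)
  · intro π h
    congr 1
    unfold mult
    congr 1
    ext B
    simp only [mem_filter, mem_erase]
    constructor
    · rintro ⟨h1, h2⟩
      refine ⟨⟨?_, h1⟩, h2⟩
      rintro rfl
      simp at h2
    · rintro ⟨⟨_, h1⟩, h2⟩
      exact ⟨h1, h2⟩

theorem close_good {n : ℕ} {t s : Finset (Fin n)} {a i : Fin n} (hta : ∀ i ∈ t, i < a)
    (has : ∀ x ∈ s, a < x) (hi : i ∈ t) (him : ∀ j ∈ t, j ≤ i)
    (π : Finset (Finset (Fin n))) (h : Good (t.erase i) s π) :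
    Good t (insert a s) (insert {i, a} π) := by
  have hia := hta i hi
  have ha : ∀ B ∈ π, a ∉ B := fun B hB h' => by
    have := h.sub B hB a h'
    grind
  have hib : ∀ B ∈ π, i ∉ B := fun B hB h' => by
    have := h.sub B hB i h'
    grind
  obtain ⟨h1, h2, h3, h4, h5, h6, h7⟩ := h
  constructor
  · grind
  · grind
  · intro x hx
    by_cases hxi : x = i ∨ x = a
    · exact ⟨{i, a}, by grind, by grind⟩
    · obtain ⟨B, hB, hxB⟩ := h3 x (by grind)
      exact ⟨B, by grind, hxB⟩
  · grind
  · intro B hB C hC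
    rw [mem_insert] at hB hC
    rcases hB with rfl | hB <;> rcases hC with rfl | hC
    · simp only [Ov]; grind
    · rintro ⟨⟨x, hx, e1⟩, ⟨x2, hx2, y2, hy2, e2⟩, e3⟩
      have l1 : i < y2 := by
        have := e1 y2 hy2
        grind
      have l2 : y2 < a := by grind
      have := h4 C hC y2 hy2
      grind
    · rintro ⟨⟨x, hx, e1⟩, ⟨x2, hx2, y2, hy2, e2⟩, ⟨y, hy, e3⟩⟩
      have l1 : x < i := by
        have := e1 i (by simp)
        grind
      have l2 : x ∈ t := by
        have := h4 B hB x hx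
        grind
      obtain ⟨z, hz, hzx⟩ := h7 B hB x hx (by grind)
      have l3 : z ∈ s := by
        have := h4 B hB z hz
        have := h6 B hB x hx z hz
        grind
      have := e3 z hz
      have := has z l3
      grind
    · exact h5 B hB C hC
  · intro B hB x hx y hy hxt hyt
    rw [mem_insert] at hB
    rcases hB with rfl | hB
    · grind
    · exact h6 B hB x hx y hy (by grind) (by grind)
  · intro B hB x hx hxt
    rw [mem_insert] at hB
    rcases hB with rfl | hB
    · grind
    · exact h7 B hB x hx (by grind)

theorem close_good' {n : ℕ} {t s : Finset (Fin n)} {a i : Fin n} (hta : ∀ i ∈ t, i < a)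
    (has : ∀ x ∈ s, a < x) (hi : i ∈ t)
    (π : Finset (Finset (Fin n))) (h : Good t (insert a s) π) (hp : {i, a} ∈ π) :
    Good (t.erase i) s (π.erase {i, a}) := by
  have hia := hta i hi
  obtain ⟨h1, h2, h3, h4, h5, h6, h7⟩ := h
  have ha : ∀ B ∈ π, a ∈ B → B = {i, a} := fun B hB h' => h2 B hB _ hp a h' (by simp)
  have hib : ∀ B ∈ π, i ∈ B → B = {i, a} := fun B hB h' => h2 B hB _ hp i h' (by simp)
  constructor
  · grind
  · grind
  · intro x hx
    obtain ⟨B, hB, hxB⟩ := h3 x (by grind)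
    exact ⟨B, by grind, hxB⟩
  · intro B hB x hx
    have := h4 B (by grind) x hx
    grind
  · grind
  · grind
  · grind

theorem close_sum {n : ℕ} {t s : Finset (Fin n)} {a i : Fin n} (hta : ∀ i ∈ t, i < a)
    (has : ∀ x ∈ s, a < x) (hi : i ∈ t) (him : ∀ j ∈ t, j ≤ i) :
    ∑ π ∈ univ.filter (fun π => Good t (insert a s) π ∧ {i, a} ∈ π),
      (X : Polynomial ℚ) ^ mult π = X * W (t.erase i) s := by
  have hia := hta i hi
  unfold W
  rw [mul_sum]
  have hn : ∀ π, Good (t.erase i) s π → ({i, a} : Finset (Fin n)) ∉ π := by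
    intro π h h'
    have := h.sub _ h' a (by simp)
    grind
  refine sum_bij' (fun π _ => π.erase {i, a}) (fun π _ => insert {i, a} π) ?_ ?_ ?_ ?_ ?_
  · intro π h
    simp only [mem_filter, mem_univ, true_and] at *
    exact close_good' hta has hi π h.1 h.2
  · intro π h
    simp only [mem_filter, mem_univ, true_and] at *
    exact ⟨close_good hta has hi him π h, by simp⟩
  · intro π h
    simp only [mem_filter, mem_univ, true_and] at *
    exact insert_erase h.2
  · intro π h
    simp only [mem_filter, mem_univ, true_and] at *
    exact erase_insert (hn π h)
  · intro π h
    simp only [mem_filter, mem_univ, true_and] at h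
    rw [← pow_succ']
    congr 1
    unfold mult
    rw [filter_erase, card_erase_of_mem, Nat.sub_add_cancel]
    · apply card_pos.2
      exact ⟨{i, a}, by simp [h.2, card_pair hia.ne]⟩
    · simp [h.2, card_pair hia.ne]

theorem mult_image {n : ℕ} (π : Finset (Finset (Fin n))) (f : Finset (Fin n) → Finset (Fin n))
    (hf : ∀ B ∈ π, ∀ C ∈ π, f B = f C → B = C)
    (hc : ∀ B ∈ π, 2 ≤ (f B).card ↔ 2 ≤ B.card) : mult (π.image f) = mult π := by
  unfold mult
  rw [filter_image, card_image_of_injOn]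
  · congr 1
    apply filter_congr
    intro B hB
    exact hc B hB
  · intro B hB C hC h
    simp only [coe_filter, Set.mem_ofPred_eq] at hB hC
    exact hf B hB.1 C hC.1 h

theorem trans_good {n : ℕ} {t s : Finset (Fin n)} {a i : Fin n} (hta : ∀ i ∈ t, i < a)
    (has : ∀ x ∈ s, a < x) (hi : i ∈ t)
    (π : Finset (Finset (Fin n))) (h : Good t s π) :
    Good t (insert a s) (π.image (fun B => if i ∈ B then insert a B else B)) := by
  have hia := hta i hi
  have ha : ∀ B ∈ π, a ∉ B := fun B hB h' => by
    have := h.sub B hB a h'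
    grind
  obtain ⟨h1, h2, h3, h4, h5, h6, h7⟩ := h
  -- a larger element of the block of i
  have big : ∀ B ∈ π, i ∈ B → ∃ z ∈ B, a < z := by
    intro B hB hiB
    obtain ⟨z, hz, hzx⟩ := h7 B hB i hiB hi
    have := h4 B hB z hz
    have := h6 B hB i hiB z hz hi
    exact ⟨z, hz, by grind⟩
  constructor
  · intro B' hB'
    rw [mem_image] at hB'
    obtain ⟨B, hB, rfl⟩ := hB'
    obtain ⟨x, hx⟩ := h1 B hB
    refine ⟨x, ?_⟩
    split_ifs
    · exact mem_insert_of_mem hx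
    · exact hx
  · grind
  · intro x hx
    by_cases hxa : x = a
    · obtain ⟨B, hB, hxB⟩ := h3 i (by grind)
      exact ⟨insert a B, mem_image.2 ⟨B, hB, by simp [hxB]⟩, by grind⟩
    · obtain ⟨B, hB, hxB⟩ := h3 x (by grind)
      exact ⟨_, mem_image_of_mem _ hB, by grind⟩
  · grind
  · intro B' hB' C' hC'
    rw [mem_image] at hB' hC'
    obtain ⟨B, hB, rfl⟩ := hB'
    obtain ⟨C, hC, rfl⟩ := hC'
    have key := h5 B hB C hC
    by_cases hiB : i ∈ B <;> by_cases hiC : i ∈ C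
    · have := h2 B hB C hC i hiB hiC
      subst this
      rintro ⟨⟨x, hx, e1⟩, -⟩
      exact lt_irrefl _ (e1 x hx)
    · simp only [hiB, hiC, if_true, if_false]
      obtain ⟨z, hz, haz⟩ := big B hB hiB
      rintro ⟨⟨x, hx, e1⟩, ⟨x2, hx2, y2, hy2, e2⟩, ⟨y, hy, e3⟩⟩
      refine key ⟨?_, ?_, ⟨y, hy, by grind⟩⟩
      · rcases mem_insert.1 hx with rfl | hx
        · exact ⟨i, hiB, fun y hy => hia.trans (e1 y hy)⟩
        · exact ⟨x, hx, e1⟩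
      · rcases mem_insert.1 hx2 with rfl | hx2
        · exact ⟨z, hz, y2, hy2, e2.trans haz⟩
        · exact ⟨x2, hx2, y2, hy2, e2⟩
    · simp only [hiB, hiC, if_true, if_false]
      obtain ⟨z, hz, haz⟩ := big C hC hiC
      rintro ⟨⟨x, hx, e1⟩, ⟨x2, hx2, y2, hy2, e2⟩, ⟨y, hy, e3⟩⟩
      refine key ⟨⟨x, hx, by grind⟩, ?_, ?_⟩
      · rcases mem_insert.1 hy2 with rfl | hy2
        · exact ⟨x2, hx2, i, hiC, hia.trans e2⟩
        · exact ⟨x2, hx2, y2, hy2, e2⟩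
      · rcases mem_insert.1 hy with rfl | hy
        · exact ⟨z, hz, fun x hx => (e3 x hx).trans haz⟩
        · exact ⟨y, hy, e3⟩
    · simpa only [hiB, hiC, if_false] using key
  · grind
  · intro B' hB' x hx hxt
    rw [mem_image] at hB'
    obtain ⟨B, hB, rfl⟩ := hB'
    have hxB : x ∈ B := by grind
    obtain ⟨y, hy, hyx⟩ := h7 B hB x hxB hxt
    exact ⟨y, by grind, hyx⟩

theorem trans_good' {n : ℕ} {t s : Finset (Fin n)} {a i : Fin n} (hta : ∀ i ∈ t, i < a)
    (has : ∀ x ∈ s, a < x) (hi : i ∈ t)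
    (π : Finset (Finset (Fin n))) (h : Good t (insert a s) π)
    (hp : ∃ B ∈ π, i ∈ B ∧ a ∈ B ∧ B ≠ {i, a}) :
    Good t s (π.image (fun B => B.erase a)) := by
  have hia := hta i hi
  obtain ⟨h1, h2, h3, h4, h5, h6, h7⟩ := h
  obtain ⟨D, hD, hiD, haD, hne⟩ := hp
  have hDu : ∀ B ∈ π, a ∈ B → B = D := fun B hB h' => h2 B hB D hD a h' haD
  have big : ∃ z ∈ D, a < z := by
    have : ∃ z ∈ D, z ≠ i ∧ z ≠ a := by
      by_contra hcon
      push Not at hcon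
      apply hne
      ext x
      grind
    obtain ⟨z, hz, hzi, hza⟩ := this
    have := h4 D hD z hz
    have := h6 D hD i hiD z hz hi
    exact ⟨z, hz, by grind⟩
  obtain ⟨z, hz, haz⟩ := big
  have hnot : ∀ B ∈ π, B ≠ D → B.erase a = B := fun B hB hBD =>
    erase_eq_of_notMem fun h' => hBD (hDu B hB h')
  constructor
  · intro B' hB'
    rw [mem_image] at hB'
    obtain ⟨B, hB, rfl⟩ := hB'
    by_cases hBD : B = D
    · subst hBD; exact ⟨i, by grind⟩
    · rw [hnot B hB hBD]; exact h1 B hB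
  · grind
  · intro x hx
    obtain ⟨B, hB, hxB⟩ := h3 x (by grind)
    exact ⟨_, mem_image_of_mem _ hB, by grind⟩
  · intro B' hB' x hx
    rw [mem_image] at hB'
    obtain ⟨B, hB, rfl⟩ := hB'
    have := h4 B hB x (by grind)
    grind
  · intro B' hB' C' hC'
    rw [mem_image] at hB' hC'
    obtain ⟨B, hB, rfl⟩ := hB'
    obtain ⟨C, hC, rfl⟩ := hC'
    have key := h5 B hB C hC
    by_cases hBD : B = D <;> by_cases hCD : C = D
    · subst hBD; subst hCD
      rintro ⟨⟨x, hx, e1⟩, -⟩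
      exact lt_irrefl _ (e1 x hx)
    · subst hBD
      rw [hnot C hC hCD]
      rintro ⟨⟨x, hx, e1⟩, ⟨x2, hx2, y2, hy2, e2⟩, ⟨y, hy, e3⟩⟩
      refine key ⟨⟨x, by grind, e1⟩, ⟨x2, by grind, y2, hy2, e2⟩, ⟨y, hy, ?_⟩⟩
      intro x hx
      have := e3 z (by grind)
      grind
    · subst hCD
      rw [hnot B hB hBD]
      rintro ⟨⟨x, hx, e1⟩, ⟨x2, hx2, y2, hy2, e2⟩, ⟨y, hy, e3⟩⟩
      refine key ⟨⟨x, hx, ?_⟩, ⟨x2, hx2, y2, by grind, e2⟩, ⟨y, by grind, e3⟩⟩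
      intro y hy
      have := e1 i (by grind)
      grind
    · rwa [hnot B hB hBD, hnot C hC hCD]
  · grind
  · intro B' hB' x hx hxt
    rw [mem_image] at hB'
    obtain ⟨B, hB, rfl⟩ := hB'
    by_cases hBD : B = D
    · subst hBD
      have := hta x hxt
      exact ⟨z, by grind, by grind⟩
    · rw [hnot B hB hBD] at hx ⊢
      exact h7 B hB x hx hxt

theorem trans_sum {n : ℕ} {t s : Finset (Fin n)} {a i : Fin n} (hta : ∀ i ∈ t, i < a)
    (has : ∀ x ∈ s, a < x) (hi : i ∈ t) :
    ∑ π ∈ univ.filter (fun π => Good t (insert a s) π ∧ ∃ B ∈ π, i ∈ B ∧ a ∈ B ∧ B ≠ {i, a}),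
      (X : Polynomial ℚ) ^ mult π = W t s := by
  have hia := hta i hi
  unfold W
  have hn : ∀ π, Good t s π → ∀ B ∈ π, a ∉ B := by
    intro π h B hB h'
    have := h.sub B hB a h'
    grind
  symm
  refine sum_bij' (fun π _ => π.image (fun B => if i ∈ B then insert a B else B))
    (fun π _ => π.image (fun B => B.erase a)) ?_ ?_ ?_ ?_ ?_
  · intro π h
    simp only [mem_filter, mem_univ, true_and] at *
    refine ⟨trans_good hta has hi π h, ?_⟩
    obtain ⟨B, hB, hiB⟩ := h.cov i (Or.inl hi)
    refine ⟨insert a B, mem_image.2 ⟨B, hB, by simp [hiB]⟩, by grind, by grind, ?_⟩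
    obtain ⟨z, hz, hzi⟩ := h.mul B hB i hiB hi
    intro heq
    have h1 : z ∈ ({i, a} : Finset (Fin n)) := by rw [← heq]; grind
    have := hn π h B hB
    grind
  · intro π h
    simp only [mem_filter, mem_univ, true_and] at *
    exact trans_good' hta has hi π h.1 h.2
  · intro π h
    simp only [mem_filter, mem_univ, true_and] at *
    rw [image_image]
    conv_rhs => rw [← image_id (s := π)]
    apply image_congr
    intro B hB
    have := hn π h B hB
    simp only [Function.comp, id]
    split_ifs
    · exact erase_insert this
    · exact erase_eq_of_notMem this
  · intro π h
    simp only [mem_filter, mem_univ, true_and] at *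
    rw [image_image]
    conv_rhs => rw [← image_id (s := π)]
    apply image_congr
    intro B hB
    obtain ⟨hg, D, hD, hiD, haD, hne⟩ := h
    simp only [Function.comp, id]
    by_cases hBD : B = D
    · subst hBD
      rw [if_pos (by grind), insert_erase haD]
    · have h1 : i ∉ B := fun h' => hBD (hg.dj B hB D hD i h' hiD)
      have h2 : a ∉ B := fun h' => hBD (hg.dj B hB D hD a h' haD)
      rw [if_neg (by grind), erase_eq_of_notMem h2]
  · intro π h
    simp only [mem_filter, mem_univ, true_and] at h
    congr 1
    symm
    apply mult_image
    · intro B hB C hC heq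
      have h1 := hn π h B hB
      have h2 := hn π h C hC
      have : (if i ∈ B then insert a B else B).erase a =
        (if i ∈ C then insert a C else C).erase a := by rw [heq]
      split_ifs at this <;> simpa [h1, h2] using this
    · intro B hB
      have h1 := hn π h B hB
      split_ifs with hiB
      · obtain ⟨z, hz, hzi⟩ := h.mul B hB i hiB hi
        have : 1 < B.card := one_lt_card.2 ⟨z, hz, i, hiB, hzi⟩
        rw [card_insert_of_notMem h1]
        omega
      · rfl

theorem open_iff {n : ℕ} {t s : Finset (Fin n)} {a : Fin n} (hta : ∀ i ∈ t, i < a)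
    (has : ∀ x ∈ s, a < x) (π : Finset (Finset (Fin n))) :
    Good (insert a t) s π ↔ Good t (insert a s) π ∧ {a} ∉ π ∧
      ∀ i ∈ t, ∀ B ∈ π, i ∈ B → a ∉ B := by
  constructor
  · rintro ⟨h1, h2, h3, h4, h5, h6, h7⟩
    refine ⟨⟨h1, h2, by grind, by grind, h5, by grind, by grind⟩, ?_, ?_⟩
    · intro h
      obtain ⟨y, hy, hya⟩ := h7 _ h a (by simp) (by simp)
      simp at hy
      exact hya hy
    · intro i hi B hB hiB haB
      have := h6 B hB i hiB a haB (by grind) (by grind)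
      exact (hta i hi).ne this
  · rintro ⟨⟨h1, h2, h3, h4, h5, h6, h7⟩, ha, hb⟩
    refine ⟨h1, h2, by grind, by grind, h5, by grind, ?_⟩
    intro B hB x hx hxt
    rcases mem_insert.1 hxt with rfl | hxt
    · by_contra hcon
      push Not at hcon
      apply ha
      have : B = {x} := by ext y; grind
      rwa [← this]
    · exact h7 B hB x hx hxt

theorem close_max {n : ℕ} {t s : Finset (Fin n)} {a i j : Fin n} (hta : ∀ i ∈ t, i < a)
    (has : ∀ x ∈ s, a < x) (hi : i ∈ t) (him : ∀ j ∈ t, j ≤ i) (hj : j ∈ t)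
    (π : Finset (Finset (Fin n))) (h : Good t (insert a s) π) (hp : {j, a} ∈ π) : j = i := by
  by_contra hne
  have hlt : j < i := lt_of_le_of_ne (him j hj) hne
  have hia := hta i hi
  obtain ⟨C, hC, hiC⟩ := h.cov i (Or.inl hi)
  have hCne : C ≠ {j, a} := by
    rintro rfl
    grind
  have haC : a ∉ C := fun h' => hCne (h.dj C hC _ hp a h' (by simp))
  have hC2 : ∀ y ∈ C, y = i ∨ a < y := by
    intro y hy
    have := h.sub C hC y hy
    have := h.dis C hC i hiC y hy hi
    grind
  obtain ⟨z, hz, hzi⟩ := h.mul C hC i hiC hi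
  refine h.nop _ hp C hC ⟨⟨j, by simp, ?_⟩, ⟨a, by simp, i, hiC, hia⟩, ⟨z, hz, ?_⟩⟩
  · intro y hy
    have := hC2 y hy
    grind
  · intro x hx
    have := hC2 z hz
    grind

/-- The part of the sum where `a` joins a block of `t`. -/
theorem join_sum {n : ℕ} {t s : Finset (Fin n)} {a : Fin n} (hta : ∀ i ∈ t, i < a)
    (has : ∀ x ∈ s, a < x) :
    ∑ π ∈ univ.filter (fun π => Good t (insert a s) π ∧
        ∃ i ∈ t, ∃ B ∈ π, i ∈ B ∧ a ∈ B ∧ B ≠ {i, a}),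
      (X : Polynomial ℚ) ^ mult π = t.card * W t s := by
  have : univ.filter (fun π => Good t (insert a s) π ∧
        ∃ i ∈ t, ∃ B ∈ π, i ∈ B ∧ a ∈ B ∧ B ≠ {i, a}) =
      t.biUnion (fun i => univ.filter (fun π => Good t (insert a s) π ∧
        ∃ B ∈ π, i ∈ B ∧ a ∈ B ∧ B ≠ {i, a})) := by
    ext π
    simp only [mem_filter, mem_univ, true_and, mem_biUnion]
    tauto
  rw [this, sum_biUnion]
  · rw [sum_congr rfl (fun i hi => trans_sum hta has hi)]
    simp
  · intro i hi j hj hij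
    rw [Function.onFun, disjoint_left]
    intro π h1 h2
    simp only [mem_filter, mem_univ, true_and] at h1 h2
    obtain ⟨hg, B, hB, hiB, haB, -⟩ := h1
    obtain ⟨-, C, hC, hjC, haC, -⟩ := h2
    have := hg.dj B hB C hC a haB haC
    subst this
    exact hij (hg.dis B hB i hiB j hjC hi hj)

theorem W_split {n : ℕ} {t s : Finset (Fin n)} {a : Fin n} (hta : ∀ i ∈ t, i < a)
    (has : ∀ x ∈ s, a < x) :
    W t (insert a s) = W (insert a t) s + W t s + t.card * W t s +
      ∑ π ∈ univ.filter (fun π => Good t (insert a s) π ∧ ∃ i ∈ t, {i, a} ∈ π),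
        (X : Polynomial ℚ) ^ mult π := by
  rw [← join_sum hta has]
  conv_lhs => unfold W
  rw [← sing_sum hta has, W]
  simp only [sum_filter, ← sum_add_distrib]
  apply sum_congr rfl
  intro π _
  rw [open_iff hta has]
  by_cases hg : Good t (insert a s) π
  swap
  · simp [hg]
  simp only [hg, true_and, if_true]
  obtain ⟨D, hD, haD⟩ := hg.cov a (by simp)
  have hDu : ∀ B ∈ π, a ∈ B → B = D := fun B hB h' => hg.dj B hB D hD a h' haD
  by_cases hs : {a} ∈ π
  · have : D = {a} := (hDu _ hs (by simp)).symm
    subst this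
    have e2 : ¬ ∃ i ∈ t, ∃ B ∈ π, i ∈ B ∧ a ∈ B ∧ B ≠ {i, a} := by grind
    have e3 : ¬ ∃ i ∈ t, {i, a} ∈ π := by
      rintro ⟨i, hi, h⟩
      have h1 := hDu _ h (by simp)
      have : i ∈ ({a} : Finset (Fin n)) := by rw [← h1]; simp
      have := hta i hi
      grind
    simp only [hs, e2, e3, not_true_eq_false, false_and, if_false, if_true]
    ring
  by_cases ht : ∃ i ∈ t, i ∈ D
  · obtain ⟨i, hi, hiD⟩ := ht
    have e1 : ¬ ∀ i ∈ t, ∀ B ∈ π, i ∈ B → a ∉ B := fun h => h i hi D hD hiD haD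
    have hu : ∀ j ∈ t, j ∈ D → j = i := fun j hj hjD => hg.dis D hD j hjD i hiD hj hi
    by_cases hp : D = {i, a}
    · have e2 : ¬ ∃ i ∈ t, ∃ B ∈ π, i ∈ B ∧ a ∈ B ∧ B ≠ {i, a} := by
        rintro ⟨j, hj, B, hB, hjB, haB, hne⟩
        have := hDu B hB haB
        subst this
        have := hu j hj hjB
        subst this
        exact hne hp
      have e3 : ∃ i ∈ t, {i, a} ∈ π := ⟨i, hi, hp ▸ hD⟩
      simp only [hs, e1, e2, e3, and_false, if_false, if_true]
      ring
    · have e2 : ∃ i ∈ t, ∃ B ∈ π, i ∈ B ∧ a ∈ B ∧ B ≠ {i, a} :=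
        ⟨i, hi, D, hD, hiD, haD, hp⟩
      have e3 : ¬ ∃ i ∈ t, {i, a} ∈ π := by
        rintro ⟨j, hj, h⟩
        have h1 := hDu _ h (by simp)
        have h2 := hu j hj (by rw [← h1]; simp)
        subst h2
        exact hp h1.symm
      simp only [hs, e1, e2, e3, and_false, if_false, if_true]
      ring
  · have e1 : ∀ i ∈ t, ∀ B ∈ π, i ∈ B → a ∉ B := by
      intro i hi B hB hiB haB
      exact ht ⟨i, hi, hDu B hB haB ▸ hiB⟩
    have e2 : ¬ ∃ i ∈ t, ∃ B ∈ π, i ∈ B ∧ a ∈ B ∧ B ≠ {i, a} := by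
      rintro ⟨i, hi, B, hB, hiB, haB, -⟩
      exact e1 i hi B hB hiB haB
    have e3 : ¬ ∃ i ∈ t, {i, a} ∈ π := by
      rintro ⟨i, hi, h⟩
      exact e1 i hi _ h (by simp) (by simp)
    rw [if_pos ⟨hs, e1⟩, if_neg hs, if_neg e2, if_neg e3]
    ring

theorem W_eq {n : ℕ} (m : ℕ) : ∀ t s : Finset (Fin n), s.card = m →
    (∀ i ∈ t, ∀ x ∈ s, i < x) → W t s = X ^ t.card * PP m t.card := by
  induction m with
  | zero =>
    intro t s hs _
    rw [card_eq_zero] at hs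
    subst hs
    rcases t.eq_empty_or_nonempty with rfl | ⟨i, hi⟩
    · have : univ.filter (Good (∅ : Finset (Fin n)) ∅) = {∅} := by
        ext π
        simp only [mem_filter, mem_univ, true_and, mem_singleton]
        constructor
        · intro h
          rw [eq_empty_iff_forall_notMem]
          intro B hB
          obtain ⟨x, hx⟩ := h.ne B hB
          have := h.sub B hB x hx
          simp at this
        · rintro rfl
          constructor <;> simp
      rw [W, this]
      simp [mult, PP]
    · have : univ.filter (Good t ∅) = ∅ := by
        rw [eq_empty_iff_forall_notMem]
        intro π h
        simp only [mem_filter, mem_univ, true_and] at h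
        obtain ⟨B, hB, hiB⟩ := h.cov i (Or.inl hi)
        obtain ⟨y, hy, hyi⟩ := h.mul B hB i hiB hi
        have h1 := h.sub B hB y hy
        simp only [notMem_empty, or_false] at h1
        exact hyi (h.dis B hB y hy i hiB h1 hi)
      rw [W, this]
      obtain ⟨c, hc⟩ := Nat.exists_eq_succ_of_ne_zero (card_pos.2 ⟨i, hi⟩).ne'
      simp [hc, PP]
  | succ m ih =>
    intro t s hs hts
    have hne : s.Nonempty := card_pos.1 (by omega)
    obtain ⟨a, s', ha, rfl⟩ : ∃ a s', (∀ x ∈ s', a < x) ∧ s = insert a s' := by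
      refine ⟨s.min' hne, s.erase (s.min' hne), ?_, (insert_erase (s.min'_mem hne)).symm⟩
      intro x hx
      exact s.min'_lt_of_mem_erase_min' hne hx
    have has : a ∉ s' := fun h => lt_irrefl _ (ha a h)
    rw [card_insert_of_notMem has] at hs
    have hs' : s'.card = m := by omega
    have hta : ∀ i ∈ t, i < a := fun i hi => hts i hi a (by simp)
    have hat : a ∉ t := fun h => lt_irrefl _ (hta a h)
    rw [W_split hta ha, ih (insert a t) s' hs' (by grind), ih t s' hs' (by grind),
      card_insert_of_notMem hat]
    rcases t.eq_empty_or_nonempty with rfl | htne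
    · simp [PP]
      ring
    · have hi := t.max'_mem htne
      have him : ∀ j ∈ t, j ≤ t.max' htne := fun j hj => t.le_max' j hj
      generalize t.max' htne = i at hi him
      have : univ.filter (fun π => Good t (insert a s') π ∧ ∃ i ∈ t, {i, a} ∈ π) =
          univ.filter (fun π => Good t (insert a s') π ∧ {i, a} ∈ π) := by
        apply filter_congr
        intro π _
        constructor
        · rintro ⟨hg, j, hj, h⟩
          have := close_max hta ha hi him hj π hg h
          subst this
          exact ⟨hg, h⟩
        · rintro ⟨hg, h⟩
          exact ⟨hg, i, hi, h⟩
      rw [this, close_sum hta ha hi him, ih (t.erase i) s' hs' (by grind)]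
      obtain ⟨c, hc⟩ := Nat.exists_eq_succ_of_ne_zero (card_pos.2 htne).ne'
      rw [card_erase_of_mem hi, hc]
      simp only [Nat.succ_eq_add_one, Nat.add_sub_cancel, PP]
      push_cast
      ring

theorem good_parts {n : ℕ} (π : Finpartition (univ : Finset (Fin n))) (h : IsNOP π) :
    Good ∅ univ π.parts := by
  constructor
  · intro B hB
    exact π.nonempty_of_mem_parts hB
  · intro B hB C hC x hx hy
    exact π.eq_of_mem_parts hB hC hx hy
  · intro x _
    exact π.exists_mem (mem_univ x)
  · simp
  · intro B hB C hC hO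
    exact h B hB C hC ((overlap_iff B C).2 hO)
  · simp
  · simp

theorem card_eq {n : ℕ} (k : ℕ) :
    (univ.filter (fun π : Finpartition (univ : Finset (Fin n)) =>
        IsNOP π ∧ (π.parts.filter (fun β : Finset (Fin n) => 2 ≤ β.card)).card = k)).card =
    (univ.filter (fun π : Finset (Finset (Fin n)) => Good ∅ univ π ∧ mult π = k)).card := by
  apply card_bij (fun π _ => π.parts)
  · intro π h
    simp only [mem_filter, mem_univ, true_and] at *
    exact ⟨good_parts π h.1, h.2⟩
  · intro π _ π' _ h
    exact Finpartition.ext h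
  · intro π h
    simp only [mem_filter, mem_univ, true_and] at h
    obtain ⟨hg, hk⟩ := h
    refine ⟨Finpartition.ofExistsUnique π (by simp) ?_ ?_, ?_, ?_⟩
    · intro x _
      obtain ⟨B, hB, hx⟩ := hg.cov x (by simp)
      exact ⟨B, ⟨hB, hx⟩, fun C hC => hg.dj C hC.1 B hB x hC.2 hx⟩
    · intro h
      obtain ⟨x, hx⟩ := hg.ne _ h
      simp at hx
    · simp only [mem_filter, mem_univ, true_and]
      refine ⟨?_, hk⟩
      intro B hB C hC hO
      exact hg.nop B hB C hC ((overlap_iff B C).1 hO)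
    · rfl

/-- The number of non-overlapping set partitions of `[n]` with exactly `k` multiplets (blocks
with at least two elements) equals the coefficient of `u^(k+1)` in `F (n+1)`, where `F 1 = u`
and `F (m+1) = u·(F m)' + Σ_{s=1}^{m−1} (F s)·(F (m−s))`. -/
theorem card_nops_with_multiplets_eq_coeff
    (F : ℕ → Polynomial ℚ)
    (hF1 : F 1 = X)
    (hF : ∀ m, 1 ≤ m →
      F (m + 1) = X * derivative (F m) + ∑ s ∈ Icc 1 (m - 1), F s * F (m - s))
    (n k : ℕ) :
    ((univ.filter (fun π : Finpartition (univ : Finset (Fin n)) =>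
        IsNOP π ∧ (π.parts.filter (fun β : Finset (Fin n) => 2 ≤ β.card)).card = k)).card : ℚ)
      = (F (n + 1)).coeff (k + 1) := by
  rw [F_eq F hF1 hF, coeff_X_mul, card_eq]
  have := W_eq n (∅ : Finset (Fin n)) univ (by simp) (by simp)
  simp only [card_empty, pow_zero, one_mul] at this
  rw [← this, W, finsetSum_coeff]
  simp only [coeff_X_pow]
  rw [← filter_filter, card_filter]
  push_cast
  apply sum_congr rfl
  intro π _
  by_cases h : mult π = k
  · simp [h]
  · rw [if_neg h, if_neg (fun h' => h h'.symm)]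
end

section
/- For every natural number n, the number of set partitions of [n] = {1,…,n} (the n-th Bell number) equals the evaluation of the polynomial (D + X_1)^n(1) ∈ MvPolynomial ℕ ℚ at X_i = 1 for all i, where D is the unique derivation on MvPolynomial ℕ ℚ with D(X_i) = X_{i+1}. -/
open Finset MvPolynomial

/-- Insert a new element `a` into the block `t` (or as a singleton block if `t = ∅`). -/
def insertPart {α : Type*} [DecidableEq α] {s : Finset α} {a : α} (ha : a ∉ s)
    (P : Finpartition s) (t : Finset α) (ht : t ∈ insert ∅ P.parts) :
    Finpartition (insert a s) :=
  Finpartition.ofExistsUnique (insert (insert a t) (P.parts.erase t))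
    (by
      intro p hp
      have hts : t ⊆ s := by
        rcases Finset.mem_insert.1 ht with rfl | h
        · simp
        · exact P.subset h
      rcases Finset.mem_insert.1 hp with rfl | h
      · exact Finset.insert_subset_insert _ hts
      · exact (P.subset (Finset.mem_of_mem_erase h)).trans (Finset.subset_insert _ _))
    (by
      intro x hx
      have key : ∀ p ∈ P.parts, a ∉ p := fun p hp h => ha (P.subset hp h)
      by_cases hxa : x = a
      · subst hxa
        refine ⟨insert x t, by simp, ?_⟩
        rintro y ⟨hy, hxy⟩
        rcases Finset.mem_insert.1 hy with rfl | h
        · rfl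
        · exact absurd hxy (key _ (Finset.mem_of_mem_erase h))
      · have hxs : x ∈ s := by simpa [hxa] using hx
        obtain ⟨q, hq, hxq⟩ := P.exists_mem hxs
        by_cases hqt : q = t
        · subst hqt
          refine ⟨insert a q, by simp [hxq], ?_⟩
          rintro y ⟨hy, hxy⟩
          rcases Finset.mem_insert.1 hy with rfl | h
          · rfl
          · exact absurd (P.eq_of_mem_parts (Finset.mem_of_mem_erase h) hq hxy hxq)
              (Finset.ne_of_mem_erase h)
        · refine ⟨q, by simp [hxq, hqt, hq], ?_⟩
          rintro y ⟨hy, hxy⟩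
          rcases Finset.mem_insert.1 hy with rfl | h
          · have hxt : x ∈ t := by simpa [hxa] using hxy
            rcases Finset.mem_insert.1 ht with rfl | h
            · simp at hxt
            · exact absurd (P.eq_of_mem_parts hq h hxq hxt) hqt
          · exact P.eq_of_mem_parts (Finset.mem_of_mem_erase h) hq hxy hxq)
    (by
      intro h
      rcases Finset.mem_insert.1 h with h | h
      · exact (Finset.insert_ne_empty _ _) h.symm
      · exact P.empty_notMem_parts (Finset.mem_of_mem_erase h))

theorem insertPart_parts {α : Type*} [DecidableEq α] {s : Finset α} {a : α} (ha : a ∉ s)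
    (P : Finpartition s) (t : Finset α) (ht : t ∈ insert ∅ P.parts) :
    (insertPart ha P t ht).parts = insert (insert a t) (P.parts.erase t) := rfl

/-- Delete the element `a`. -/
def removeElt {α : Type*} [DecidableEq α] {s : Finset α} {a : α} (ha : a ∉ s)
    (Q : Finpartition (insert a s)) : Finpartition s :=
  (Q.avoid {a}).copy (by rw [Finset.insert_sdiff_of_mem _ (by simp)]; simp [ha])

theorem mem_removeElt {α : Type*} [DecidableEq α] {s : Finset α} {a : α} (ha : a ∉ s)
    (Q : Finpartition (insert a s)) (c : Finset α) :
    c ∈ (removeElt ha Q).parts ↔ c ≠ ∅ ∧ ∃ d ∈ Q.parts, d.erase a = c := by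
  simp only [removeElt, Finpartition.copy_parts, Finpartition.mem_avoid,
    Finset.sdiff_singleton_eq_erase]
  constructor
  · rintro ⟨d, hd, h, rfl⟩
    refine ⟨?_, d, hd, rfl⟩
    intro h2
    apply h
    rw [Finset.erase_eq_empty_iff] at h2
    rcases h2 with h2 | h2 <;> simp [h2]
  · rintro ⟨h, d, hd, rfl⟩
    refine ⟨d, hd, ?_, rfl⟩
    intro h2
    apply h
    rw [Finset.erase_eq_empty_iff]
    simpa [Finset.subset_singleton_iff] using h2

theorem sum_insert_finpartition {α M : Type*} [DecidableEq α] [AddCommMonoid M]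
    {s : Finset α} {a : α} (ha : a ∉ s) (f : ℕ → M) :
    ∑ Q : Finpartition (insert a s), f (#Q.parts) =
      ∑ P : Finpartition s, (f (#P.parts + 1) + #P.parts • f (#P.parts)) := by
  have h1 : ∀ P : Finpartition s, f (#P.parts + 1) + #P.parts • f (#P.parts) =
      ∑ t ∈ insert ∅ P.parts, f (#(P.parts.erase t) + 1) := by
    intro P
    rw [Finset.sum_insert P.empty_notMem_parts, Finset.erase_eq_of_notMem P.empty_notMem_parts]
    congr 1
    rw [← Finset.sum_const]
    exact Finset.sum_congr rfl fun t ht => by rw [Finset.card_erase_add_one ht]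
  simp_rw [h1]
  rw [Finset.sum_sigma']
  symm
  have hpart : ∀ (P : Finpartition s) (t : Finset α) (ht : t ∈ insert ∅ P.parts),
      (insertPart ha P t ht).part a = insert a t := by
    intro P t ht
    apply Finpartition.part_eq_of_mem
    · simp [insertPart_parts]
    · simp
  have hta : ∀ (P : Finpartition s) (t : Finset α), t ∈ insert ∅ P.parts → a ∉ t := by
    intro P t ht h
    rcases Finset.mem_insert.1 ht with rfl | h'
    · simp at h
    · exact ha (P.subset h' h)
  have hmem : ∀ Q : Finpartition (insert a s),
      (Q.part a).erase a ∈ insert ∅ (removeElt ha Q).parts := by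
    intro Q
    rw [Finset.mem_insert, mem_removeElt, or_iff_not_imp_left]
    intro h
    exact ⟨h, _, by simp, rfl⟩
  refine Finset.sum_bij' (fun x hx => insertPart ha x.1 x.2 (Finset.mem_sigma.1 hx).2)
    (fun Q _ => ⟨removeElt ha Q, (Q.part a).erase a⟩) ?_ ?_ ?_ ?_ ?_
  · intros; simp
  · intro Q _
    simpa using hmem Q
  · rintro ⟨P, t⟩ hx
    have ht := (Finset.mem_sigma.1 hx).2
    have h2 := hta P t ht
    have h3 : removeElt ha (insertPart ha P t ht) = P := by
      ext1
      ext c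
      rw [mem_removeElt]
      simp only [insertPart_parts, Finset.mem_insert, Finset.mem_erase, exists_eq_or_imp,
        Finset.erase_insert h2]
      constructor
      · rintro ⟨hc, rfl | ⟨d, ⟨_, hd⟩, rfl⟩⟩
        · exact (Finset.mem_insert.1 ht).resolve_left hc
        · rwa [Finset.erase_eq_of_notMem (fun h => ha (P.subset hd h))]
      · intro hc
        refine ⟨P.ne_empty hc, ?_⟩
        by_cases hct : c = t
        · exact Or.inl hct.symm
        · exact Or.inr ⟨c, ⟨hct, hc⟩, Finset.erase_eq_of_notMem (fun h => ha (P.subset hc h))⟩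
    simp only [hpart, Finset.erase_insert h2]
    rw [h3]
  · intro Q _
    ext1
    ext c
    have haQ : a ∈ Q.part a := by simp
    have hQ : Q.part a ∈ Q.parts := by simp
    simp only [insertPart_parts, Finset.mem_insert, Finset.mem_erase, mem_removeElt,
      Finset.insert_erase haQ]
    constructor
    · rintro (rfl | ⟨h, hc, d, hd, rfl⟩)
      · exact hQ
      · by_cases had : a ∈ d
        · rw [Q.part_eq_of_mem hd had] at h
          exact absurd rfl h
        · rwa [Finset.erase_eq_of_notMem had]
    · intro hc
      by_cases hac : a ∈ c
      · exact Or.inl (Q.part_eq_of_mem hc hac).symm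
      · refine Or.inr ⟨?_, Q.ne_empty hc, c, hc, Finset.erase_eq_of_notMem hac⟩
        intro h
        obtain ⟨x, hx⟩ := Q.nonempty_of_mem_parts hc
        have : x ∈ Q.part a := Finset.mem_of_mem_erase (h ▸ hx)
        exact hac (Q.eq_of_mem_parts hc hQ hx this ▸ haQ)
  · rintro ⟨P, t⟩ hx
    have ht := (Finset.mem_sigma.1 hx).2
    have h2 := hta P t ht
    simp only [insertPart_parts]
    rw [Finset.card_insert_of_notMem]
    intro h
    exact ha (P.subset (Finset.mem_of_mem_erase h) (by simp))

theorem aeval_D (D : Derivation ℚ (MvPolynomial ℕ ℚ) (MvPolynomial ℕ ℚ))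
    (hD : ∀ i, D (X i) = X (i + 1)) (p : MvPolynomial ℕ ℚ) :
    aeval (fun _ : ℕ => (Polynomial.X : Polynomial ℚ)) (D p) =
      Polynomial.X * Polynomial.derivative
        (aeval (fun _ : ℕ => (Polynomial.X : Polynomial ℚ)) p) := by
  induction p using MvPolynomial.induction_on with
  | C r => simp [← MvPolynomial.algebraMap_eq]
  | add p q hp hq => simp [hp, hq, mul_add]
  | mul_X p i hp =>
    simp [hp, hD]
    ring

theorem aeval_iterate (D : Derivation ℚ (MvPolynomial ℕ ℚ) (MvPolynomial ℕ ℚ))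
    (hD : ∀ i, D (X i) = X (i + 1)) {α : Type*} [DecidableEq α] (s : Finset α) :
    aeval (fun _ : ℕ => (Polynomial.X : Polynomial ℚ)) ((fun p => D p + X 1 * p)^[#s] 1) =
      ∑ P : Finpartition s, (Polynomial.X : Polynomial ℚ) ^ #P.parts := by
  induction s using Finset.induction_on with
  | empty =>
    have h : ∀ P : Finpartition (∅ : Finset α), P.parts = ∅ := fun P => by
      rw [Finpartition.parts_eq_empty_iff]; rfl
    have hc : Fintype.card (Finpartition (∅ : Finset α)) = 1 := by
      rw [Fintype.card_eq_one_iff]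
      exact ⟨Finpartition.empty _, fun Q => by ext1; rw [h, h]⟩
    simp [h, hc]
  | insert a s ha ih =>
    rw [Finset.card_insert_of_notMem ha, Function.iterate_succ_apply',
      sum_insert_finpartition ha (fun k => (Polynomial.X : Polynomial ℚ) ^ k), map_add, map_mul,
      aeval_D D hD, ih, Polynomial.derivative_sum, aeval_X, Finset.mul_sum, Finset.mul_sum,
      ← Finset.sum_add_distrib]
    refine Finset.sum_congr rfl fun P _ => ?_
    have : ∀ k : ℕ, (Polynomial.X : Polynomial ℚ) * Polynomial.derivative (Polynomial.X ^ k) =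
        k • Polynomial.X ^ k := by
      intro k
      cases k with
      | zero => simp
      | succ k =>
        rw [Polynomial.derivative_X_pow, nsmul_eq_mul, Polynomial.C_eq_natCast,
          Nat.add_sub_cancel, pow_succ]
        ring
    rw [this, pow_succ']
    ring

/-- The `n`-th Bell number, i.e. the number of set partitions of `[n]`, equals the evaluation of
the Bell polynomial `Yₙ = (D + X 1)^n (1)` at `X i = 1` for all `i`, where `D` is the derivation
on `MvPolynomial ℕ ℚ` sending `X i ↦ X (i+1)`. -/
theorem bell_number_eq_eval_one
    (n : ℕ) (D : Derivation ℚ (MvPolynomial ℕ ℚ) (MvPolynomial ℕ ℚ))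
    (hD : ∀ i, D (X i) = X (i + 1)) :
    (Fintype.card (Finpartition (univ : Finset (Fin n))) : ℚ) =
      eval (fun _ => (1 : ℚ)) ((fun p => D p + X 1 * p)^[n] 1) := by
  have h := congrArg (Polynomial.aeval (1 : ℚ)) (aeval_iterate D hD (univ : Finset (Fin n)))
  have h2 : ∀ p : MvPolynomial ℕ ℚ, Polynomial.aeval (1 : ℚ)
      (aeval (fun _ : ℕ => (Polynomial.X : Polynomial ℚ)) p) = eval (fun _ => (1 : ℚ)) p := by
    intro p
    rw [← MvPolynomial.coe_aeval_eq_eval, ← AlgHom.comp_apply, MvPolynomial.comp_aeval]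
    simp
  rw [h2, Finset.card_univ, Fintype.card_fin] at h
  rw [h]
  simp
end
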